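/- Let d ≥ 2 and r > 0. Then ∫_{ℝ^d} K_r^{(d)}(v) dv = (A_r^d)², where A_r^d := d r^{d−1} π^{d/2} / Γ(d/2 + 1) is the surface area of a ball of radius r in ℝ^d. -/

import Mathlib

open MeasureTheory Filter
open scoped Classical

/-- The kernel `K_r^{(d)} : ℝ^d → [0,∞]`, equal to
`2r²π^{(d-1)/2}(r² - ‖v‖²/4)^{(d-3)/2} / (Γ((d-1)/2)‖v‖)` for `0 < ‖v‖ < 2r`, to `0` for
`‖v‖ > 2r`, and to `+∞` when `v = 0` or `‖v‖ = 2r`. -/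
noncomputable def kernelK (d : ℕ) (r : ℝ) (v : EuclideanSpace ℝ (Fin d)) : ENNReal :=
  if v = 0 ∨ ‖v‖ = 2 * r then ⊤
  else if 2 * r < ‖v‖ then 0
  else ENNReal.ofReal (2 * r ^ 2 * Real.pi ^ (((d : ℝ) - 1) / 2) *
    (r ^ 2 - ‖v‖ ^ 2 / 4) ^ (((d : ℝ) - 3) / 2) / (Real.Gamma (((d : ℝ) - 1) / 2) * ‖v‖))

/-- `A_r^d = d r^{d-1} π^{d/2} / Γ(d/2 + 1)`, the `(d-1)`-dimensional surface area of a ball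
of radius `r` in `ℝ^d`. -/
noncomputable def surfArea (d : ℕ) (r : ℝ) : ℝ :=
  d * r ^ (d - 1) * Real.pi ^ ((d : ℝ) / 2) / Real.Gamma ((d : ℝ) / 2 + 1)

open Set in
/-- Polar coordinates for the Lebesgue integral of a radial function. -/
lemma lintegral_fun_norm_addHaar {E : Type*} [NormedAddCommGroup E] [NormedSpace ℝ E]
    [MeasurableSpace E] [Nontrivial E] (μ : Measure E) [FiniteDimensional ℝ E] [BorelSpace E]
    [μ.IsAddHaarMeasure] {f : ℝ → ENNReal} (hf : Measurable f) :
    ∫⁻ x, f ‖x‖ ∂μ = Module.finrank ℝ E * μ (Metric.ball 0 1) *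
      ∫⁻ y in Ioi (0 : ℝ), ENNReal.ofReal (y ^ (Module.finrank ℝ E - 1)) * f y :=
  calc
    ∫⁻ x, f ‖x‖ ∂μ = ∫⁻ x : ({(0)}ᶜ : Set E), f ‖x.1‖ ∂(μ.comap (↑)) := by
      rw [lintegral_subtype_comap (measurableSet_singleton _).compl fun x ↦ f ‖x‖,
        restrict_compl_singleton]
    _ = ∫⁻ x, f x.2 ∂μ.toSphere.prod (.volumeIoiPow (Module.finrank ℝ E - 1)) := by
      simpa using μ.measurePreserving_homeomorphUnitSphereProd.lintegral_comp
        (f := fun x ↦ f x.2) (by fun_prop)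
    _ = μ.toSphere univ * ∫⁻ x : Ioi (0 : ℝ), f x ∂.volumeIoiPow (Module.finrank ℝ E - 1) := by
      rw [lintegral_prod _ (by fun_prop)]
      simp [mul_comm]
    _ = _ := by
      rw [Measure.volumeIoiPow, lintegral_withDensity_eq_lintegral_mul _ (by fun_prop)
        (by fun_prop), μ.toSphere_apply_univ]
      congr 1
      exact lintegral_subtype_comap measurableSet_Ioi
        fun a ↦ ENNReal.ofReal (a ^ (Module.finrank ℝ E - 1)) * f a

open Set in
/-- The beta integral after the substitution `t = x² / (2r)²`. -/
lemma lintegral_beta_sq {a r : ℝ} (ha : 0 < a) (hr : 0 < r) :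
    ∫⁻ x in Ioo 0 (2 * r), ENNReal.ofReal (x / (2 * r ^ 2) *
      ((x ^ 2 / (4 * r ^ 2)) ^ (a - 1) * (1 - x ^ 2 / (4 * r ^ 2)) ^ (a - 1))) =
      ENNReal.ofReal (ProbabilityTheory.beta a a) := by
  have hB := ProbabilityTheory.beta_pos ha ha
  have himage : (fun x : ℝ ↦ x ^ 2 / (4 * r ^ 2)) '' Ioo 0 (2 * r) = Ioo 0 1 := by
    ext t
    constructor
    · rintro ⟨x, ⟨hx0, hx1⟩, rfl⟩
      refine ⟨by positivity, ?_⟩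
      rw [div_lt_one (by positivity)]
      nlinarith
    · rintro ⟨ht0, ht1⟩
      refine ⟨2 * r * √t, ⟨by positivity, ?_⟩, ?_⟩
      · have : √t < 1 := by rw [Real.sqrt_lt' one_pos]; simpa using ht1
        nlinarith
      · simp only [mul_pow, Real.sq_sqrt ht0.le]
        field_simp
        norm_num
  have hinj : InjOn (fun x : ℝ ↦ x ^ 2 / (4 * r ^ 2)) (Ioo 0 (2 * r)) := by
    intro x hx y hy h
    simp only at h
    rw [div_left_inj' (by positivity)] at h
    exact (sq_eq_sq₀ hx.1.le hy.1.le).1 h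
  have hderiv : ∀ x ∈ Ioo 0 (2 * r), HasDerivWithinAt (fun x : ℝ ↦ x ^ 2 / (4 * r ^ 2))
      (x / (2 * r ^ 2)) (Ioo 0 (2 * r)) x := by
    intro x _
    convert! ((hasDerivAt_pow 2 x).div_const (4 * r ^ 2)).hasDerivWithinAt using 1
    field_simp
    norm_num [mul_comm]
  have h1 := ProbabilityTheory.lintegral_betaPDF_eq_one ha ha
  rw [ProbabilityTheory.lintegral_betaPDF, ← himage,
    lintegral_image_eq_lintegral_abs_deriv_mul measurableSet_Ioo hderiv hinj] at h1
  rw [← mul_one (ENNReal.ofReal _), ← h1, ← lintegral_const_mul' _ _ ENNReal.ofReal_ne_top]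
  refine setLIntegral_congr_fun measurableSet_Ioo fun x hx ↦ ?_
  have hx0 := hx.1
  rw [abs_of_pos (by positivity), ← ENNReal.ofReal_mul (by positivity),
    ← ENNReal.ofReal_mul hB.le]
  congr 1
  field_simp

lemma pow_mul_kernel_eq {d : ℕ} (hd : 2 ≤ d) {r x a : ℝ} (hr : 0 < r) (hx : 0 < x)
    (hxr : x < 2 * r) (ha : a = ((d : ℝ) - 1) / 2) :
    x ^ (d - 1) * (2 * r ^ 2 * Real.pi ^ a * (r ^ 2 - x ^ 2 / 4) ^ (a - 1) /
      (Real.Gamma a * x)) =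
    Real.pi ^ a / Real.Gamma a * (4 ^ a * (r ^ (d - 1)) ^ 2) *
      (x / (2 * r ^ 2) *
        ((x ^ 2 / (4 * r ^ 2)) ^ (a - 1) * (1 - x ^ 2 / (4 * r ^ 2)) ^ (a - 1))) := by
  have hpow : ∀ y : ℝ, 0 < y → y ^ (d - 1) = (y ^ 2) ^ a := by
    intro y hy
    rw [← Real.rpow_natCast y 2, ← Real.rpow_mul hy.le, ← Real.rpow_natCast,
      Nat.cast_sub (by omega), ha]
    congr 1
    push_cast
    ring
  have hq : 0 < x ^ 2 / (4 * r ^ 2) := by positivity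
  have h1 : 0 < 1 - x ^ 2 / (4 * r ^ 2) := by
    rw [sub_pos, div_lt_one (by positivity)]
    nlinarith
  have h2 : r ^ 2 - x ^ 2 / 4 = r ^ 2 * (1 - x ^ 2 / (4 * r ^ 2)) := by
    field_simp
  have h3 : x ^ 2 = 4 * r ^ 2 * (x ^ 2 / (4 * r ^ 2)) := by field_simp
  have h4 : x ^ (d - 1) = 4 ^ a * r ^ (d - 1) * ((x ^ 2 / (4 * r ^ 2)) ^ (a - 1) *
      (x ^ 2 / (4 * r ^ 2))) := by
    rw [hpow x hx, h3, Real.mul_rpow (by positivity) hq.le, Real.mul_rpow (by norm_num)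
      (by positivity), ← hpow r hr, ← h3, Real.rpow_sub_one hq.ne']
    field_simp
  have h5 : (r ^ 2) ^ (a - 1) = r ^ (d - 1) / r ^ 2 := by
    rw [Real.rpow_sub_one (by positivity), ← hpow r hr]
  have hG : Real.Gamma a ≠ 0 := by
    have : (2 : ℝ) ≤ d := by exact_mod_cast hd
    exact (Real.Gamma_pos_of_pos (by linarith)).ne'
  rw [h4, h2, Real.mul_rpow (by positivity) h1.le, h5]
  generalize (x ^ 2 / (4 * r ^ 2)) ^ (a - 1) = X
  generalize (1 - x ^ 2 / (4 * r ^ 2)) ^ (a - 1) = Y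
  field_simp
  norm_num

lemma surfArea_sq_eq {d : ℕ} (hd : 2 ≤ d) (r : ℝ) {a : ℝ} (ha : a = ((d : ℝ) - 1) / 2) :
    d * (√Real.pi ^ d / Real.Gamma ((d : ℝ) / 2 + 1)) *
      (Real.pi ^ a / Real.Gamma a * (4 ^ a * (r ^ (d - 1)) ^ 2) *
        ProbabilityTheory.beta a a) = surfArea d r ^ 2 := by
  have hd' : (2 : ℝ) ≤ d := by exact_mod_cast hd
  have ha0 : 0 < a := by linarith
  have hda : (d : ℝ) / 2 = a + 1 / 2 := by linarith
  have hsqrt : √Real.pi ^ d = Real.pi ^ ((d : ℝ) / 2) := by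
    rw [Real.sqrt_eq_rpow, ← Real.rpow_natCast, ← Real.rpow_mul Real.pi_pos.le]
    congr 1
    ring
  have hleg := Real.Gamma_mul_Gamma_add_half a
  have h2 : (2 : ℝ) ^ (1 - 2 * a) = 2 / 4 ^ a := by
    rw [Real.rpow_sub two_pos, Real.rpow_one, Real.rpow_mul two_pos.le]
    norm_num
  have hpi : Real.pi ^ (a + 1 / 2) = Real.pi ^ a * √Real.pi := by
    rw [Real.rpow_add Real.pi_pos, Real.sqrt_eq_rpow]
  have hG := Real.Gamma_pos_of_pos ha0
  have hG2 : 0 < Real.Gamma (2 * a) := Real.Gamma_pos_of_pos (by linarith)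
  have hGh : 0 < Real.Gamma (a + 1 / 2) := Real.Gamma_pos_of_pos (by linarith)
  have h4 : (0 : ℝ) < 4 ^ a := by positivity
  have hdd : (d : ℝ) = 2 * (a + 1 / 2) := by linarith
  have hs : (0 : ℝ) < a + 1 / 2 := by linarith
  rw [h2] at hleg
  rw [surfArea, hsqrt, hda, Real.Gamma_add_one hs.ne', hpi, ProbabilityTheory.beta,
    ← two_mul a, hdd]
  generalize a + 1 / 2 = s at *
  have hpi0 : 0 < √Real.pi := by positivity
  have hpa : 0 < Real.pi ^ a := by positivity
  generalize Real.pi ^ a = p at *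
  generalize √Real.pi = q at *
  generalize (4 : ℝ) ^ a = w at *
  have hG' : Real.Gamma a = Real.Gamma (2 * a) * (2 / w) * q / Real.Gamma s := by
    rw [← hleg]; field_simp
  rw [hG']
  field_simp

/-- `∫_{ℝ^d} K_r^{(d)}(v) dv = (A_r^d)²`. -/
theorem integral_of_kernel (d : ℕ) (hd : 2 ≤ d) (r : ℝ) (hr : 0 < r) :
    ∫⁻ v, kernelK d r v = ENNReal.ofReal ((surfArea d r) ^ 2) := by
  have : Nonempty (Fin d) := ⟨⟨0, by omega⟩⟩
  have hd' : (2 : ℝ) ≤ d := by exact_mod_cast hd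
  obtain ⟨a, ha⟩ : ∃ a : ℝ, a = ((d : ℝ) - 1) / 2 := ⟨_, rfl⟩
  have ha0 : 0 < a := by linarith
  have ha1 : ((d : ℝ) - 3) / 2 = a - 1 := by linarith
  have hG := Real.Gamma_pos_of_pos ha0
  set F : ℝ → ENNReal := fun x ↦ ENNReal.ofReal (2 * r ^ 2 * Real.pi ^ a *
    (r ^ 2 - x ^ 2 / 4) ^ (a - 1) / (Real.Gamma a * x)) with hF
  have hFm : Measurable ((Set.Iio (2 * r)).indicator F) :=
    Measurable.indicator (by fun_prop) measurableSet_Iio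
  have hae : (fun v ↦ kernelK d r v) =ᵐ[volume] fun v ↦ (Set.Iio (2 * r)).indicator F ‖v‖ := by
    have h0 : ∀ᵐ v : EuclideanSpace ℝ (Fin d), v ≠ 0 := by
      simp [ae_iff]
    have h1 : ∀ᵐ v : EuclideanSpace ℝ (Fin d), v ∉ Metric.sphere 0 (2 * r) :=
      measure_eq_zero_iff_ae_notMem.1 (Measure.addHaar_sphere _ _ _)
    filter_upwards [h0, h1] with v hv0 hv1
    rw [mem_sphere_zero_iff_norm] at hv1
    rw [kernelK, if_neg (by tauto), ← ha, ha1]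
    rcases lt_or_gt_of_ne hv1 with h | h
    · rw [if_neg h.not_gt, Set.indicator_of_mem (Set.mem_Iio.2 h)]
    · rw [if_pos h, Set.indicator_of_notMem (by simpa using h.le)]
  have hball : (d : ENNReal) * volume (Metric.ball (0 : EuclideanSpace ℝ (Fin d)) 1) =
      ENNReal.ofReal (d * (√Real.pi ^ d / Real.Gamma ((d : ℝ) / 2 + 1))) := by
    rw [EuclideanSpace.volume_ball, ENNReal.ofReal_mul (by positivity)]
    simp
  have hC : 0 ≤ Real.pi ^ a / Real.Gamma a * (4 ^ a * (r ^ (d - 1)) ^ 2) := by positivity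
  have hrad : ∫⁻ y in Set.Ioi (0 : ℝ), ENNReal.ofReal (y ^ (d - 1)) * (Set.Iio (2 * r)).indicator F y =
      ENNReal.ofReal (Real.pi ^ a / Real.Gamma a * (4 ^ a * (r ^ (d - 1)) ^ 2) *
        ProbabilityTheory.beta a a) := by
    rw [ENNReal.ofReal_mul hC, ← lintegral_beta_sq ha0 hr,
      ← lintegral_const_mul' _ _ ENNReal.ofReal_ne_top]
    have : ∀ y : ℝ, ENNReal.ofReal (y ^ (d - 1)) * (Set.Iio (2 * r)).indicator F y =
        (Set.Iio (2 * r)).indicator (fun y ↦ ENNReal.ofReal (y ^ (d - 1)) * F y) y := by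
      intro y
      by_cases hy : y ∈ Set.Iio (2 * r) <;> simp [hy]
    simp_rw [this]
    rw [setLIntegral_indicator measurableSet_Iio, Set.inter_comm, Set.Ioi_inter_Iio]
    refine setLIntegral_congr_fun measurableSet_Ioo fun x hx ↦ ?_
    have hx0 := hx.1
    simp only [hF]
    rw [← ENNReal.ofReal_mul (by positivity), ← ENNReal.ofReal_mul hC,
      pow_mul_kernel_eq hd hr hx.1 hx.2 ha]
  have hGd : 0 < Real.Gamma ((d : ℝ) / 2 + 1) := Real.Gamma_pos_of_pos (by positivity)
  rw [lintegral_congr_ae hae, lintegral_fun_norm_addHaar volume hFm, finrank_euclideanSpace_fin,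
    hball, hrad, ← ENNReal.ofReal_mul (by positivity), surfArea_sq_eq hd r ha]
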